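/- The balancing element g = K^{p+1} ∈ U is grouplike and implements the square of the antipode of U: Δ(g) = g ⊗ g, ε(g) = 1, and g x g⁻¹ = S²(x) for all x ∈ U; moreover ι(g) = r⁻¹u in D, where u = Σ_i S(β_i)α_i is the Drinfeld element of (D,R) and r is the ribbon element. -/

import Mathlib

open scoped TensorProduct
open Finset

noncomputable section

namespace LogHennings

/-- `q = exp(iπ/p)`. -/
def qq (p : ℕ) : ℂ := Complex.exp ((Real.pi : ℂ) * Complex.I / (p : ℂ))

/-- `q^{1/2} = exp(iπ/(2p))`. -/
def qh (p : ℕ) : ℂ := Complex.exp ((Real.pi : ℂ) * Complex.I / (2 * (p : ℂ)))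

/-- quantum integer `[m] = (q^m - q^{-m})/(q - q⁻¹)`. -/
def qnum (p m : ℕ) : ℂ := ((qq p) ^ m - (qq p)⁻¹ ^ m) / (qq p - (qq p)⁻¹)

/-- quantum factorial `[m]! = [m][m-1]⋯[1]`. -/
def qfac (p : ℕ) : ℕ → ℂ
  | 0 => 1
  | m + 1 => qnum p (m + 1) * qfac p m

/-- Generators of the restricted quantum group `U`. -/
inductive UGen | E | F | K | Kinv

abbrev FU := FreeAlgebra ℂ UGen

def fE : FU := FreeAlgebra.ι ℂ UGen.E
def fF : FU := FreeAlgebra.ι ℂ UGen.F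
def fK : FU := FreeAlgebra.ι ℂ UGen.K
def fKinv : FU := FreeAlgebra.ι ℂ UGen.Kinv

/-- Defining relations of the restricted quantum group `U`. -/
inductive URel (p : ℕ) : FU → FU → Prop
  | Epow : URel p (fE ^ p) 0
  | Fpow : URel p (fF ^ p) 0
  | Kpow : URel p (fK ^ (2 * p)) 1
  | KKinv : URel p (fK * fKinv) 1
  | KinvK : URel p (fKinv * fK) 1
  | KE : URel p (fK * fE * fKinv) ((qq p) ^ 2 • fE)
  | KF : URel p (fK * fF * fKinv) (((qq p) ^ 2)⁻¹ • fF)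
  | EF : URel p (fE * fF - fF * fE) ((qq p - (qq p)⁻¹)⁻¹ • (fK - fKinv))

/-- The restricted quantum group `U = \bar U_q(sl2)`. -/
abbrev Uq (p : ℕ) := RingQuot (URel p)

def UE (p : ℕ) : Uq p := RingQuot.mkAlgHom ℂ (URel p) fE
def UF (p : ℕ) : Uq p := RingQuot.mkAlgHom ℂ (URel p) fF
def UK (p : ℕ) : Uq p := RingQuot.mkAlgHom ℂ (URel p) fK
def UKinv (p : ℕ) : Uq p := RingQuot.mkAlgHom ℂ (URel p) fKinv

/-- Generators of the braided extension `D`. -/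
inductive DGen | e | phi | k | kinv

abbrev FD := FreeAlgebra ℂ DGen

def fe : FD := FreeAlgebra.ι ℂ DGen.e
def fphi : FD := FreeAlgebra.ι ℂ DGen.phi
def fk : FD := FreeAlgebra.ι ℂ DGen.k
def fkinv : FD := FreeAlgebra.ι ℂ DGen.kinv

/-- Defining relations of `D`. -/
inductive DRel (p : ℕ) : FD → FD → Prop
  | epow : DRel p (fe ^ p) 0
  | phipow : DRel p (fphi ^ p) 0
  | kpow : DRel p (fk ^ (4 * p)) 1
  | kkinv : DRel p (fk * fkinv) 1
  | kinvk : DRel p (fkinv * fk) 1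
  | ke : DRel p (fk * fe * fkinv) (qq p • fe)
  | kphi : DRel p (fk * fphi * fkinv) ((qq p)⁻¹ • fphi)
  | ephi : DRel p (fe * fphi - fphi * fe)
      ((qq p - (qq p)⁻¹)⁻¹ • (fk ^ 2 - fkinv ^ 2))

/-- The braided extension `D` of `U`. -/
abbrev Dq (p : ℕ) := RingQuot (DRel p)

def De (p : ℕ) : Dq p := RingQuot.mkAlgHom ℂ (DRel p) fe
def Dphi (p : ℕ) : Dq p := RingQuot.mkAlgHom ℂ (DRel p) fphi
def Dk (p : ℕ) : Dq p := RingQuot.mkAlgHom ℂ (DRel p) fk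
def Dkinv (p : ℕ) : Dq p := RingQuot.mkAlgHom ℂ (DRel p) fkinv

/-- The `R`-matrix of `D`. -/
def Rmat (p : ℕ) : Dq p ⊗[ℂ] Dq p :=
  ((4 * (p : ℂ))⁻¹) •
    ∑ m ∈ range p, ∑ n ∈ range (4 * p), ∑ j ∈ range (4 * p),
      (((qq p - (qq p)⁻¹) ^ m / qfac p m) *
          (qh p) ^ ((m : ℤ) * ((m : ℤ) - 1) + 2 * (m : ℤ) * ((n : ℤ) - (j : ℤ))
            - (n : ℤ) * (j : ℤ))) •
        ((De p ^ m * Dk p ^ n) ⊗ₜ[ℂ] (Dphi p ^ m * Dk p ^ j))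

/-- `R₂₁ = τ(R)`. -/
def R21 (p : ℕ) : Dq p ⊗[ℂ] Dq p := TensorProduct.comm ℂ (Dq p) (Dq p) (Rmat p)

/-- The monodromy `M = R₂₁ R`. -/
def Mmat (p : ℕ) : Dq p ⊗[ℂ] Dq p := R21 p * Rmat p

/-- The ribbon element `r ∈ D`. -/
def rib (p : ℕ) : Dq p :=
  ((1 - Complex.I) / (2 * (Real.sqrt p : ℂ))) •
    ∑ m ∈ range p, ∑ j ∈ range (2 * p),
      (((qq p - (qq p)⁻¹) ^ m / qfac p m) *
          (qh p) ^ (-(m : ℤ) + 2 * (m : ℤ) * (j : ℤ) + ((j : ℤ) + (p : ℤ) + 1) ^ 2)) •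
        (Dphi p ^ m * De p ^ m * Dk p ^ (2 * j))

/-- The Drinfeld element `u = Σ S(β_i) α_i` for `R = Σ α_i ⊗ β_i`,
depending on a choice of antipode `S`. -/
def drinfeldU (p : ℕ) (S : Dq p →ₗ[ℂ] Dq p) : Dq p :=
  LinearMap.mul' ℂ (Dq p) (TensorProduct.map S LinearMap.id (R21 p))

/-- `Δ` takes the prescribed values on the generators of `U`. -/
def IsDeltaU (p : ℕ) (Δ : Uq p →ₐ[ℂ] Uq p ⊗[ℂ] Uq p) : Prop :=
  Δ (UE p) = 1 ⊗ₜ[ℂ] UE p + UE p ⊗ₜ[ℂ] UK p ∧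
  Δ (UF p) = UKinv p ⊗ₜ[ℂ] UF p + UF p ⊗ₜ[ℂ] 1 ∧
  Δ (UK p) = UK p ⊗ₜ[ℂ] UK p ∧
  Δ (UKinv p) = UKinv p ⊗ₜ[ℂ] UKinv p

/-- `ε` takes the prescribed values on the generators of `U`. -/
def IsCounitU (p : ℕ) (ε : Uq p →ₐ[ℂ] ℂ) : Prop :=
  ε (UE p) = 0 ∧ ε (UF p) = 0 ∧ ε (UK p) = 1 ∧ ε (UKinv p) = 1

/-- `S` is an algebra anti-homomorphism taking the prescribed values on the
generators of `U`. -/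
def IsAntipodeU (p : ℕ) (S : Uq p →ₗ[ℂ] Uq p) : Prop :=
  S 1 = 1 ∧ (∀ x y, S (x * y) = S y * S x) ∧
  S (UE p) = -(UE p * UKinv p) ∧ S (UF p) = -(UK p * UF p) ∧
  S (UK p) = UKinv p ∧ S (UKinv p) = UK p

/-- `Δ` takes the prescribed values on the generators of `D`. -/
def IsDeltaD (p : ℕ) (Δ : Dq p →ₐ[ℂ] Dq p ⊗[ℂ] Dq p) : Prop :=
  Δ (De p) = 1 ⊗ₜ[ℂ] De p + De p ⊗ₜ[ℂ] (Dk p ^ 2) ∧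
  Δ (Dphi p) = (Dkinv p ^ 2) ⊗ₜ[ℂ] Dphi p + Dphi p ⊗ₜ[ℂ] 1 ∧
  Δ (Dk p) = Dk p ⊗ₜ[ℂ] Dk p ∧
  Δ (Dkinv p) = Dkinv p ⊗ₜ[ℂ] Dkinv p

/-- `ε` takes the prescribed values on the generators of `D`. -/
def IsCounitD (p : ℕ) (ε : Dq p →ₐ[ℂ] ℂ) : Prop :=
  ε (De p) = 0 ∧ ε (Dphi p) = 0 ∧ ε (Dk p) = 1 ∧ ε (Dkinv p) = 1

/-- `S` is an algebra anti-homomorphism taking the prescribed values on the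
generators of `D`. -/
def IsAntipodeD (p : ℕ) (S : Dq p →ₗ[ℂ] Dq p) : Prop :=
  S 1 = 1 ∧ (∀ x y, S (x * y) = S y * S x) ∧
  S (De p) = -(De p * Dkinv p ^ 2) ∧ S (Dphi p) = -(Dk p ^ 2 * Dphi p) ∧
  S (Dk p) = Dkinv p ∧ S (Dkinv p) = Dk p

/-- `ι` takes the prescribed values `E ↦ e`, `F ↦ φ`, `K^{±1} ↦ k^{±2}`. -/
def IsIota (p : ℕ) (ι : Uq p →ₐ[ℂ] Dq p) : Prop :=
  ι (UE p) = De p ∧ ι (UF p) = Dphi p ∧ ι (UK p) = Dk p ^ 2 ∧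
  ι (UKinv p) = Dkinv p ^ 2

/-- `μ` takes the prescribed values on the PBW basis of `U`. -/
def IsMu (p : ℕ) (μ : Uq p →ₗ[ℂ] ℂ) : Prop :=
  ∀ m n l : ℕ, m < p → n < p → l < 2 * p →
    μ (UE p ^ m * UF p ^ n * UK p ^ l) =
      if m = p - 1 ∧ n = p - 1 ∧ l = p + 1 then
        -((Real.sqrt (2 / (p : ℝ)) : ℂ)) * (qfac p (p - 1)) ^ 2
      else 0

variable {A : Type*} [Ring A] [Algebra ℂ A]

/-- Coassociativity of a comultiplication. -/
def Coassoc (Δ : A →ₐ[ℂ] A ⊗[ℂ] A) : Prop :=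
  ∀ x, TensorProduct.assoc ℂ A A A
      (TensorProduct.map Δ.toLinearMap LinearMap.id (Δ x)) =
    TensorProduct.map LinearMap.id Δ.toLinearMap (Δ x)

/-- The counit axiom. -/
def CounitAxiom (Δ : A →ₐ[ℂ] A ⊗[ℂ] A) (ε : A →ₐ[ℂ] ℂ) : Prop :=
  (∀ x, TensorProduct.lid ℂ A
      (TensorProduct.map ε.toLinearMap LinearMap.id (Δ x)) = x) ∧
  (∀ x, TensorProduct.rid ℂ A
      (TensorProduct.map LinearMap.id ε.toLinearMap (Δ x)) = x)

/-- The antipode axiom. -/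
def AntipodeAxiom (Δ : A →ₐ[ℂ] A ⊗[ℂ] A) (ε : A →ₐ[ℂ] ℂ)
    (S : A →ₗ[ℂ] A) : Prop :=
  (∀ x, LinearMap.mul' ℂ A (TensorProduct.map S LinearMap.id (Δ x)) = ε x • 1) ∧
  (∀ x, LinearMap.mul' ℂ A (TensorProduct.map LinearMap.id S (Δ x)) = ε x • 1)

/-- `x ↦ x ⊗ 1`. -/
def e1 (p : ℕ) : Dq p →ₗ[ℂ] Dq p ⊗[ℂ] Dq p :=
  (TensorProduct.mk ℂ (Dq p) (Dq p)).flip 1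

/-- `x ↦ 1 ⊗ x`. -/
def e2 (p : ℕ) : Dq p →ₗ[ℂ] Dq p ⊗[ℂ] Dq p :=
  TensorProduct.mk ℂ (Dq p) (Dq p) 1

/-- The balancing element `g = K^{p+1}`. -/
def gU (p : ℕ) : Uq p := UK p ^ (p + 1)

/-- The span of commutators `[U,U]`. -/
def commSpan (p : ℕ) : Submodule ℂ (Uq p) :=
  Submodule.span ℂ {z : Uq p | ∃ x y : Uq p, z = x * y - y * x}

end LogHennings
namespace LogHennings

section Gauss
open Complex Filter Topology

lemma ofReal_mul_cpow {r : ℝ} (hr : 0 < r) {x : ℂ} (hx : x ≠ 0) (s : ℂ) :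
    ((r : ℂ) * x) ^ s = (r : ℂ) ^ s * x ^ s := by
  have hr' : (r : ℂ) ≠ 0 := by exact_mod_cast hr.ne'
  rw [cpow_def_of_ne_zero (mul_ne_zero hr' hx), cpow_def_of_ne_zero hr', cpow_def_of_ne_zero hx,
    log_ofReal_mul hr hx, add_mul, Complex.exp_add, ofReal_log hr.le]

lemma theta_split (M : ℕ) (hM : 0 < M) (hMe : Even M) (t : ℝ) (ht : 0 < t) :
    jacobiTheta (1 / (M : ℂ) + I * t) =
      ∑ a ∈ range M, cexp (Real.pi * I * (a : ℂ) ^ 2 / M) *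
        (HurwitzZeta.evenKernel ((a / M : ℝ) : UnitAddCircle) ((M : ℝ) ^ 2 * t) : ℂ) := by
  have : NeZero M := ⟨hM.ne'⟩
  have hM0 : (M : ℂ) ≠ 0 := by exact_mod_cast hM.ne'
  have hM0r : (M : ℝ) ≠ 0 := by exact_mod_cast hM.ne'
  have him : 0 < (1 / (M : ℂ) + I * t).im := by
    rw [show (1 / (M : ℂ) + I * t) = ((1 / (M : ℝ) : ℝ) : ℂ) + t * I by push_cast; ring]
    simp only [add_im, ofReal_im, mul_im, ofReal_re, I_re, I_im]
    linarith
  have h1 := hasSum_jacobiTheta₂_term 0 him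
  rw [← jacobiTheta_eq_jacobiTheta₂] at h1
  have h2 := ((Int.divModEquiv M).symm.trans (Equiv.refl ℤ)).hasSum_iff.mpr h1
  have h3 := ((Equiv.prodComm (Fin M) ℤ).hasSum_iff.mpr h2)
  have h4 : ∀ a : Fin M, HasSum (fun n : ℤ => cexp (Real.pi * I * (a : ℂ) ^ 2 / M) *
      ((Real.exp (-Real.pi * (n + ((a : ℕ) / M : ℝ)) ^ 2 * ((M : ℝ) ^ 2 * t)) : ℝ) : ℂ))
      (cexp (Real.pi * I * (a : ℂ) ^ 2 / M) *
        (HurwitzZeta.evenKernel (((a : ℕ) / M : ℝ) : UnitAddCircle) ((M : ℝ) ^ 2 * t) : ℂ)) := by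
    intro a
    apply HasSum.mul_left
    rw [hasSum_ofReal]
    exact HurwitzZeta.hasSum_int_evenKernel _ (by positivity)
  have h5 := h3.prod_fiberwise (g := fun a : Fin M => cexp (Real.pi * I * (a : ℂ) ^ 2 / M) *
        (HurwitzZeta.evenKernel (((a : ℕ) / M : ℝ) : UnitAddCircle) ((M : ℝ) ^ 2 * t) : ℂ)) ?_
  · rw [← Fin.sum_univ_eq_sum_range (fun a : ℕ => cexp (Real.pi * I * (a : ℂ) ^ 2 / M) *
        (HurwitzZeta.evenKernel ((a / M : ℝ) : UnitAddCircle) ((M : ℝ) ^ 2 * t) : ℂ))]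
    exact h5.unique (hasSum_fintype _)
  · intro a
    convert h4 a using 2 with n
    simp only [Function.comp_apply, Equiv.prodComm_apply, Prod.swap_prod_mk, 
      Int.divModEquiv_symm_apply, jacobiTheta₂_term, Equiv.coe_trans,
      Equiv.coe_refl, id]
    obtain ⟨c, hc⟩ := hMe
    have hcM : (M : ℂ) = c + c := by exact_mod_cast hc
    rw [ofReal_exp, ← Complex.exp_add, Complex.exp_eq_exp_iff_exists_int]
    refine ⟨n * n * c + n * a, ?_⟩
    push_cast
    field_simp
    rw [hcM]
    ring_nf
    simp only [I_sq]
    ring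

lemma evenKernel_lim (M : ℕ) (hM : 0 < M) (a : ℝ) :
    Tendsto (fun t : ℝ => Real.sqrt t * HurwitzZeta.evenKernel (a : UnitAddCircle)
      ((M : ℝ) ^ 2 * t)) (𝓝[>] 0) (𝓝 (1 / M)) := by
  have hM0r : (0 : ℝ) < M := by exact_mod_cast hM
  obtain ⟨c, hc, hO⟩ := HurwitzZeta.isBigO_atTop_cosKernel_sub (a : UnitAddCircle)
  have h1 : Tendsto (fun x => HurwitzZeta.cosKernel (a : UnitAddCircle) x) atTop (𝓝 1) := by
    have h2 : Tendsto (fun x : ℝ => Real.exp (-c * x)) atTop (𝓝 0) := by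
      apply Real.tendsto_exp_atBot.comp
      exact tendsto_id.const_mul_atTop_of_neg (by linarith)
    have := (hO.trans_tendsto h2).add_const 1
    simpa using this
  have h3 : Tendsto (fun t : ℝ => 1 / ((M : ℝ) ^ 2 * t)) (𝓝[>] 0) atTop := by
    have : Tendsto (fun t : ℝ => (1 / (M : ℝ) ^ 2) * t⁻¹) (𝓝[>] 0) atTop :=
      tendsto_inv_nhdsGT_zero.const_mul_atTop (by positivity)
    refine this.congr fun t => ?_
    rw [one_div, one_div, mul_inv]
  have h4 := (h1.comp h3).const_mul (1 / (M : ℝ))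
  rw [mul_one] at h4
  refine h4.congr' ?_
  filter_upwards [self_mem_nhdsWithin] with t ht
  have ht' : (0 : ℝ) < t := ht
  rw [HurwitzZeta.evenKernel_functional_equation, ← Real.sqrt_eq_rpow,
    Real.sqrt_mul (by positivity), Real.sqrt_sq hM0r.le]
  have : Real.sqrt t ≠ 0 := (Real.sqrt_pos.mpr ht').ne'
  simp only [Function.comp_apply]
  field_simp

lemma jt_fe (τ : ℂ) : jacobiTheta τ = 1 / (-I * τ) ^ (1 / 2 : ℂ) * jacobiTheta (-1 / τ) := by
  have := jacobiTheta₂_functional_equation 0 τ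
  simpa [jacobiTheta_eq_jacobiTheta₂] using this

lemma jt_add (c : ℕ) (τ : ℂ) : jacobiTheta (τ + 2 * c) = jacobiTheta τ := by
  induction c with
  | zero => simp
  | succ n ih =>
    rw [← ih, ← jacobiTheta_two_add (τ + 2 * n)]
    congr 1; push_cast; ring

lemma theta_lim (M : ℕ) (hM : 0 < M) (hMe : Even M) :
    Tendsto (fun t : ℝ => (Real.sqrt t : ℂ) * jacobiTheta (1 / (M : ℂ) + I * t)) (𝓝[>] 0)
      (𝓝 (1 / (M : ℂ) * (1 / (-I * (1 / (M : ℂ))) ^ (1 / 2 : ℂ)))) := by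
  have hM0r : (0 : ℝ) < M := by exact_mod_cast hM
  have hM0 : (M : ℂ) ≠ 0 := by exact_mod_cast hM.ne'
  have hid : Tendsto (fun t : ℝ => (t : ℂ)) (𝓝[>] 0) (𝓝 0) := by
    have : Tendsto (fun t : ℝ => (t : ℂ)) (𝓝 0) (𝓝 ((0 : ℝ) : ℂ)) :=
      Complex.continuous_ofReal.tendsto 0
    simpa using this.mono_left nhdsWithin_le_nhds
  -- the factor from the first transformation
  have hA : Tendsto (fun t : ℝ => (-I * (1 / (M : ℂ) + I * t)) ^ (1 / 2 : ℂ)) (𝓝[>] 0)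
      (𝓝 ((-I * (1 / (M : ℂ))) ^ (1 / 2 : ℂ))) := by
    have h1 : Tendsto (fun t : ℝ => -I * (1 / (M : ℂ) + I * t)) (𝓝[>] 0)
        (𝓝 (-I * (1 / (M : ℂ)))) := by
      have := ((hid.const_mul I).const_add (1 / (M : ℂ))).const_mul (-I)
      simpa using this
    have hs : -I * (1 / (M : ℂ)) ∈ slitPlane := by
      right
      rw [show -I * (1 / (M : ℂ)) = ((-(1 / M : ℝ) : ℝ) : ℂ) * I by push_cast; ring]
      simp [hM.ne']
    exact (continuousAt_cpow_const hs).tendsto.comp h1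
  have hA0 : (-I * (1 / (M : ℂ))) ^ (1 / 2 : ℂ) ≠ 0 := by
    rw [Ne, cpow_eq_zero_iff]
    simp [hM0]
  -- the factor from the second transformation
  have hB : Tendsto (fun t : ℝ => ((M : ℂ) ^ 2 / (1 + I * M * t)) ^ (1 / 2 : ℂ)) (𝓝[>] 0)
      (𝓝 (M : ℂ)) := by
    have h1 : Tendsto (fun t : ℝ => (M : ℂ) ^ 2 / (1 + I * M * t)) (𝓝[>] 0)
        (𝓝 ((M : ℂ) ^ 2)) := by
      have := (tendsto_const_nhds (x := (M : ℂ) ^ 2)).div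
        ((hid.const_mul (I * M)).const_add 1) (by simp)
      simpa [Pi.div_def] using this
    have hs : (M : ℂ) ^ 2 ∈ slitPlane := by
      left
      rw [show (M : ℂ) ^ 2 = (((M : ℝ) ^ 2 : ℝ) : ℂ) by push_cast; ring, ofReal_re]
      positivity
    have h2 := (continuousAt_cpow_const (b := (1 / 2 : ℂ)) hs).tendsto.comp h1
    have h3 : ((M : ℂ) ^ 2) ^ (1 / 2 : ℂ) = M := by
      rw [show (M : ℂ) ^ 2 = (((M : ℝ) ^ 2 : ℝ) : ℂ) by push_cast; ring,
        show (1 / 2 : ℂ) = ((1 / 2 : ℝ) : ℂ) by push_cast; ring, ← ofReal_cpow (by positivity),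
        ← Real.sqrt_eq_rpow, Real.sqrt_sq hM0r.le]
      simp
    rw [h3] at h2
    exact h2
  -- the remaining theta value tends to one
  have hC : Tendsto (fun t : ℝ => jacobiTheta (I / (M ^ 2 * t) - 1 / M)) (𝓝[>] 0) (𝓝 1) := by
    have him : ∀ t : ℝ, (I / ((M : ℂ) ^ 2 * t) - 1 / M).im = (1 / (M : ℝ) ^ 2) * t⁻¹ := by
      intro t
      rw [show (I / ((M : ℂ) ^ 2 * t) - 1 / M) =
        (((1 / (M : ℝ) ^ 2) * t⁻¹ : ℝ) : ℂ) * I + ((-(1 / M) : ℝ) : ℂ) by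
          push_cast; rw [div_eq_mul_inv I, mul_inv]; ring]
      simp only [add_im, ofReal_im, mul_im, ofReal_re, I_re, I_im]
      ring
    have hi : Tendsto (fun t : ℝ => (I / ((M : ℂ) ^ 2 * t) - 1 / M)) (𝓝[>] 0)
        (comap im atTop) := by
      rw [tendsto_comap_iff]
      have : Tendsto (fun t : ℝ => (1 / (M : ℝ) ^ 2) * t⁻¹) (𝓝[>] 0) atTop :=
        tendsto_inv_nhdsGT_zero.const_mul_atTop (by positivity)
      exact this.congr fun t => (him t).symm
    have h0 : Tendsto (fun τ : ℂ => Real.exp (-Real.pi * τ.im)) (comap im atTop) (𝓝 0) := by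
      apply Real.tendsto_exp_atBot.comp
      exact tendsto_comap.const_mul_atTop_of_neg (by linarith [Real.pi_pos])
    have h1 := ((isBigO_at_im_infty_jacobiTheta_sub_one.trans_tendsto h0).comp hi).add_const 1
    simpa using h1
  have h := ((hA.inv₀ hA0).mul (hB.inv₀ hM0)).mul hC
  rw [mul_one, mul_comm ((_)⁻¹), ← one_div, ← one_div] at h
  refine h.congr' ?_
  filter_upwards [self_mem_nhdsWithin] with t ht
  have ht' : (0 : ℝ) < t := ht
  have htC : (t : ℂ) ≠ 0 := by exact_mod_cast ht'.ne'
  have hs : (Real.sqrt t : ℂ) ≠ 0 := by exact_mod_cast (Real.sqrt_pos.mpr ht').ne'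
  have hden : (1 + I * M * t : ℂ) ≠ 0 := by
    intro h0
    have := congrArg re h0
    simp at this
  obtain ⟨c, hc⟩ := hMe
  have hcM : (M : ℂ) = 2 * c := by rw [hc]; push_cast; ring
  have e1 : -1 / (1 / (M : ℂ) + I * t) + 2 * c = I * (M ^ 2 * t / (1 + I * M * t)) := by
    rw [← hcM]
    have : (1 / (M : ℂ) + I * t) = (1 + I * M * t) / M := by field_simp
    rw [this]
    field_simp
    ring
  have e2 : -1 / (I * (M ^ 2 * t / (1 + I * M * t)) : ℂ) = I / (M ^ 2 * t) - 1 / M := by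
    field_simp
    ring_nf
    simp only [I_sq]
    ring
  have e3 : -I * (I * (M ^ 2 * t / (1 + I * M * t)) : ℂ) = (t : ℝ) * (M ^ 2 / (1 + I * M * t)) := by
    ring_nf
    simp only [I_sq]
    ring
  rw [jt_fe (1 / (M : ℂ) + I * t), ← jt_add c (-1 / (1 / (M : ℂ) + I * t)), e1, jt_fe (I * _), e2, e3,
    ofReal_mul_cpow ht' (div_ne_zero (pow_ne_zero 2 hM0) hden)]
  have e4 : (t : ℂ) ^ (1 / 2 : ℂ) = Real.sqrt t := by
    rw [show (1 / 2 : ℂ) = ((1 / 2 : ℝ) : ℂ) by push_cast; ring, ← ofReal_cpow ht'.le,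
        ← Real.sqrt_eq_rpow]
  rw [e4]
  simp only [one_div, mul_inv]
  field_simp

lemma gauss_even (M : ℕ) (hM : 0 < M) (hMe : Even M) :
    ∑ a ∈ range M, cexp (Real.pi * I * (a : ℂ) ^ 2 / M) =
      1 / (-I * (1 / (M : ℂ))) ^ (1 / 2 : ℂ) := by
  have hM0 : (M : ℂ) ≠ 0 := by exact_mod_cast hM.ne'
  have h1 := theta_lim M hM hMe
  have h2 : Tendsto (fun t : ℝ => ∑ a ∈ range M, cexp (Real.pi * I * (a : ℂ) ^ 2 / M) *
      ((Real.sqrt t * HurwitzZeta.evenKernel ((a / M : ℝ) : UnitAddCircle)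
        ((M : ℝ) ^ 2 * t) : ℝ) : ℂ)) (𝓝[>] 0)
      (𝓝 (∑ a ∈ range M, cexp (Real.pi * I * (a : ℂ) ^ 2 / M) * ((1 / M : ℝ) : ℂ))) := by
    apply tendsto_finsetSum
    intro a _
    apply Tendsto.const_mul
    exact (Complex.continuous_ofReal.tendsto _).comp (evenKernel_lim M hM (a / M))
  have h3 := tendsto_nhds_unique (h1.congr' ?_) h2
  · rw [← Finset.sum_mul] at h3
    push_cast at h3
    rw [mul_comm] at h3
    exact (mul_right_cancel₀ (by simpa using hM0) h3).symm
  · filter_upwards [self_mem_nhdsWithin] with t ht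
    rw [theta_split M hM hMe t ht, Finset.mul_sum]
    apply Finset.sum_congr rfl
    intro a _
    push_cast
    ring

lemma gauss_val (p : ℕ) (hp : 0 < p) :
    ∑ a ∈ range (2 * p), cexp (Real.pi * I * (a : ℂ) ^ 2 / ((2 * p : ℕ) : ℂ)) =
      (1 + I) * Real.sqrt p := by
  rw [gauss_even (2 * p) (by omega) (even_two_mul p)]
  have hpR : (0 : ℝ) < p := by exact_mod_cast hp
  have e1 : -I * (1 / ((2 * p : ℕ) : ℂ)) = ((1 / (2 * p) : ℝ) : ℂ) * (-I) := by
    push_cast; ring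
  have e2 : (1 / 2 : ℂ) = ((1 / 2 : ℝ) : ℂ) := by push_cast; ring
  have e3 : (-I) ^ (1 / 2 : ℂ) = (1 - I) * ((Real.sqrt 2)⁻¹ : ℝ) := by
    rw [cpow_def_of_ne_zero (by simp), log_neg_I]
    rw [show -(Real.pi / 2 : ℂ) * I * (1 / 2 : ℂ) = ((-(Real.pi / 4) : ℝ) : ℂ) * I by
      push_cast; ring]
    rw [exp_mul_I, ← ofReal_cos, ← ofReal_sin, Real.cos_neg, Real.sin_neg, Real.cos_pi_div_four,
      Real.sin_pi_div_four]
    have : (Real.sqrt 2)⁻¹ = Real.sqrt 2 / 2 := by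
      rw [inv_eq_one_div, div_eq_div_iff (by positivity) (by norm_num)]
      simp
    rw [this]
    push_cast
    ring
  rw [e1, ofReal_mul_cpow (by positivity) (by simp), e3, e2, ← ofReal_cpow (by positivity),
    ← Real.sqrt_eq_rpow, Real.sqrt_div zero_le_one, Real.sqrt_one, Real.sqrt_mul (by norm_num)]
  have h2 : (Real.sqrt 2 : ℂ) ≠ 0 := by
    exact_mod_cast (Real.sqrt_pos.mpr (by norm_num : (0 : ℝ) < 2)).ne'
  have h2' : (Real.sqrt 2 : ℂ) ^ 2 = 2 := by
    norm_cast
    exact Real.sq_sqrt (by norm_num)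
  have hp' : (Real.sqrt p : ℂ) ≠ 0 := by
    exact_mod_cast (Real.sqrt_pos.mpr hpR).ne'
  have hI : (1 - I) ≠ 0 := by
    intro h0
    have := congrArg re h0
    simp at this
  push_cast
  field_simp
  rw [h2']
  ring_nf
  simp only [I_sq]
  ring
end Gauss
end LogHennings

namespace LogHennings
section Scalars

lemma qh_ne (p : ℕ) : qh p ≠ 0 := Complex.exp_ne_zero _
lemma qq_ne (p : ℕ) : qq p ≠ 0 := Complex.exp_ne_zero _

lemma qq_eq (p : ℕ) : qq p = qh p ^ (2 : ℤ) := by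
  rw [qq, qh, ← Complex.exp_int_mul]
  congr 1
  push_cast
  rw [← mul_div_assoc, mul_div_mul_left _ _ two_ne_zero]

lemma qh_2p (p : ℕ) (hp : 0 < p) : qh p ^ (2 * p : ℤ) = -1 := by
  have hp' : (p : ℂ) ≠ 0 := by exact_mod_cast hp.ne'
  rw [qh, ← Complex.exp_int_mul, ← Complex.exp_pi_mul_I]
  congr 1
  push_cast
  field_simp

lemma qh_4p (p : ℕ) (hp : 0 < p) : qh p ^ (4 * p : ℤ) = 1 := by
  rw [show (4 * p : ℤ) = 2 * p + 2 * p by ring, zpow_add₀ (qh_ne p), qh_2p p hp]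
  norm_num

lemma qh_per (p : ℕ) (hp : 0 < p) (a b c : ℤ) (h : a = b + 4 * p * c) : qh p ^ a = qh p ^ b := by
  rw [h, zpow_add₀ (qh_ne p), zpow_mul, qh_4p p hp, one_zpow, mul_one]

lemma qh_half (p : ℕ) (hp : 0 < p) (a b c : ℤ) (h : a = b + 4 * p * c + 2 * p) :
    qh p ^ a = - qh p ^ b := by
  rw [h, zpow_add₀ (qh_ne p), qh_2p p hp, qh_per p hp _ b c rfl]
  ring

lemma qq_prim (p : ℕ) (hp : 0 < p) : IsPrimitiveRoot (qq p) (2 * p) := by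
  have := Complex.isPrimitiveRoot_exp (2 * p) (by omega)
  convert this using 1
  rw [qq]
  congr 1
  have hp' : (p : ℂ) ≠ 0 := by exact_mod_cast hp.ne'
  push_cast
  field_simp

lemma qq_sub_ne (p m : ℕ) (h0 : 0 < m) (hm : m < p) : qq p ^ m - (qq p)⁻¹ ^ m ≠ 0 := by
  intro h
  have h1 : qq p ^ (2 * m) = 1 := by
    rw [two_mul, pow_add]
    nth_rw 1 [sub_eq_zero.mp h]
    rw [← mul_pow, inv_mul_cancel₀ (qq_ne p), one_pow]
  have := (qq_prim p (by omega)).dvd_of_pow_eq_one _ h1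
  have := Nat.le_of_dvd (by omega) this
  omega

lemma d_ne (p : ℕ) (hp : 2 ≤ p) : qq p - (qq p)⁻¹ ≠ 0 := by
  simpa using qq_sub_ne p 1 one_pos hp

lemma qnum_ne (p : ℕ) (hp : 2 ≤ p) (m : ℕ) (h0 : 0 < m) (hm : m < p) : qnum p m ≠ 0 :=
  div_ne_zero (qq_sub_ne p m h0 hm) (d_ne p hp)

/-- the prefactor `(q-q⁻¹)^m/[m]!`. -/
def gam (p m : ℕ) : ℂ := (qq p - (qq p)⁻¹) ^ m / qfac p m

lemma gam_succ (p : ℕ) (hp : 2 ≤ p) (m : ℕ) (hm : m + 1 < p) :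
    qnum p (m + 1) / (qq p - (qq p)⁻¹) * gam p (m + 1) = gam p m := by
  have h1 := d_ne p hp
  have h2 := qnum_ne p hp (m + 1) (by omega) hm
  rw [gam, gam, qfac]
  generalize qq p - (qq p)⁻¹ = d at *
  generalize qnum p (m + 1) = x at *
  rw [div_mul_div_comm, show x * d ^ (m + 1) = d ^ m * (d * x) by ring,
    show d * (x * qfac p m) = qfac p m * (d * x) by ring,
    mul_div_mul_right _ _ (mul_ne_zero h1 h2)]

/-- coefficient of the ribbon element. -/
def Bc (p m : ℕ) (j : ℤ) : ℂ :=
  gam p m * qh p ^ (-(m : ℤ) + 2 * (m : ℤ) * j + (j + (p : ℤ) + 1) ^ 2)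

lemma Bc_per (p : ℕ) (hp : 0 < p) (m : ℕ) (j : ℤ) : Bc p m (j + (2 * p : ℕ)) = Bc p m j := by
  rw [Bc, Bc, qh_per p hp _ _ (m + (j + p + 1) + p)]
  push_cast
  ring

lemma Bc_rec (p : ℕ) (hp : 2 ≤ p) (m : ℕ) (hm : m + 1 < p) (j : ℤ) :
    Bc p m j * (qq p ^ 2) ^ j - Bc p m j =
      (qnum p (m + 1) / (qq p - (qq p)⁻¹)) *
        (qq p ^ ((m : ℤ) + 2) * Bc p (m + 1) (j - 1)
          - qq p ^ (-((m : ℤ) + 2)) * Bc p (m + 1) (j + 1)) := by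
  have h1 : qq p ^ ((m : ℤ) + 2) * Bc p (m + 1) (j - 1) =
      gam p (m + 1) * - qh p ^ (-(m : ℤ) + 2 * (m : ℤ) * j + (j + (p : ℤ) + 1) ^ 2) := by
    rw [Bc, mul_left_comm, qq_eq, ← zpow_mul, ← zpow_add₀ (qh_ne p),
      qh_half p (by omega) _ (-(m : ℤ) + 2 * (m : ℤ) * j + (j + (p : ℤ) + 1) ^ 2) (-1)]
    push_cast
    ring
  have h2 : qq p ^ (-((m : ℤ) + 2)) * Bc p (m + 1) (j + 1) =
      gam p (m + 1) * - qh p ^ (-(m : ℤ) + 2 * (m : ℤ) * j + (j + (p : ℤ) + 1) ^ 2 + 4 * j) := by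
    rw [Bc, mul_left_comm, qq_eq, ← zpow_mul, ← zpow_add₀ (qh_ne p),
      qh_half p (by omega) _ (-(m : ℤ) + 2 * (m : ℤ) * j + (j + (p : ℤ) + 1) ^ 2 + 4 * j) 0]
    push_cast
    ring
  have h3 : (qq p ^ 2) ^ j = qh p ^ (4 * j) := by
    rw [qq_eq, ← zpow_natCast, ← zpow_mul, ← zpow_mul]
    congr 1
    push_cast
    ring
  rw [h1, h2, ← mul_sub, ← mul_assoc, gam_succ p hp m hm, h3, zpow_add₀ (qh_ne p) _ (4 * j), Bc]
  ring

lemma sum_shift {M : Type*} [AddCommGroup M] (N : ℕ) (F : ℤ → M) (hF : ∀ j, F (j + N) = F j)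
    (c : ℤ) : ∑ j ∈ range N, F ((j : ℤ) + c) = ∑ j ∈ range N, F (j : ℤ) := by
  have step : ∀ c : ℤ, ∑ j ∈ range N, F ((j : ℤ) + (c + 1)) = ∑ j ∈ range N, F ((j : ℤ) + c) := by
    intro c
    have h1 := Finset.sum_range_succ (fun j : ℕ => F ((j : ℤ) + c)) N
    have h2 := Finset.sum_range_succ' (fun j : ℕ => F ((j : ℤ) + c)) N
    rw [h1] at h2
    have h3 : F ((N : ℤ) + c) = F (((0 : ℕ) : ℤ) + c) := by
      rw [add_comm, hF]; simp
    rw [h3] at h2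
    rw [add_right_cancel h2]
    refine Finset.sum_congr rfl fun j _ => ?_
    congr 1
    push_cast
    ring
  induction c using Int.induction_on with
  | zero => simp
  | succ i ih => rw [step, ih]
  | pred i ih =>
    rw [← ih, ← step]
    simp

lemma sum_qh (p : ℕ) (hp : 0 < p) (n : ℕ) (hn : n < 2 * p) (c : ℤ) :
    ∑ j ∈ range (2 * p), qh p ^ (2 * (n : ℤ) * ((j : ℤ) + c)) =
      if n = 0 then 2 * (p : ℂ) else 0 := by
  split_ifs with h
  · subst h
    simp
  · have h1 : ∀ j : ℕ, qh p ^ (2 * (n : ℤ) * ((j : ℤ) + c)) =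
        qh p ^ (2 * (n : ℤ) * c) * (qq p ^ n) ^ j := by
      intro j
      rw [qq_eq, ← zpow_natCast, ← zpow_natCast, ← zpow_mul, ← zpow_mul, ← zpow_add₀ (qh_ne p)]
      congr 1
      ring
    simp_rw [h1]
    rw [← Finset.mul_sum]
    have hne : qq p ^ n ≠ 1 := (qq_prim p hp).pow_ne_one_of_pos_of_lt h hn
    rw [geom_sum_eq hne, ← pow_mul, mul_comm n, pow_mul, (qq_prim p hp).pow_eq_one]
    simp

lemma gauss_neg (p : ℕ) (hp : 0 < p) :
    ∑ j ∈ range (4 * p), qh p ^ (-(j : ℤ) ^ 2) = 2 * ((1 - Complex.I) * (Real.sqrt p : ℂ)) := by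
  have h1 : ∑ a ∈ range (2 * p), qh p ^ ((a : ℤ) ^ 2) = (1 + Complex.I) * Real.sqrt p := by
    rw [← gauss_val p hp]
    refine Finset.sum_congr rfl fun a _ => ?_
    rw [qh, ← Complex.exp_int_mul]
    congr 1
    push_cast
    ring
  have h2 := congrArg (starRingEnd ℂ) h1
  rw [map_sum] at h2
  have h3 : ∀ a : ℕ, (starRingEnd ℂ) (qh p ^ ((a : ℤ) ^ 2)) = qh p ^ (-(a : ℤ) ^ 2) := by
    intro a
    rw [map_zpow₀, qh, ← Complex.exp_conj, zpow_neg, ← inv_zpow, ← Complex.exp_neg]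
    congr 2
    simp only [map_div₀, map_mul, Complex.conj_ofReal, Complex.conj_I, map_natCast, map_ofNat]
    ring
  simp_rw [h3] at h2
  rw [show 4 * p = 2 * p + 2 * p by ring, Finset.sum_range_add]
  have h4 : ∀ a : ℕ, qh p ^ (-((2 * p + a : ℕ) : ℤ) ^ 2) = qh p ^ (-(a : ℤ) ^ 2) := by
    intro a
    apply qh_per p hp _ _ (-(p : ℤ) - a)
    push_cast
    ring
  simp_rw [h4]
  rw [h2]
  simp only [map_mul, map_add, map_one, Complex.conj_I, Complex.conj_ofReal]
  ring

lemma gauss_t (p : ℕ) (hp : 0 < p) (s : ℤ) :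
    ∑ j ∈ range (4 * p), qh p ^ (-(j : ℤ) ^ 2 - (j : ℤ) * (2 * s)) =
      2 * ((1 - Complex.I) * (Real.sqrt p : ℂ)) * qh p ^ (s ^ 2) := by
  rw [← gauss_neg p hp, ← sum_shift (4 * p) (fun j : ℤ => qh p ^ (-j ^ 2)) _ s, Finset.sum_mul]
  · refine Finset.sum_congr rfl fun a _ => ?_
    rw [← zpow_add₀ (qh_ne p)]
    congr 1
    ring
  · intro j
    apply qh_per p hp _ _ (-2 * j - 4 * p)
    push_cast
    ring

lemma gauss_odd (p : ℕ) (hp : 0 < p) (s : ℤ) :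
    ∑ j ∈ range (4 * p), qh p ^ (-(j : ℤ) ^ 2 - (j : ℤ) * (2 * s + 1)) = 0 := by
  have h := sum_shift (4 * p) (fun j : ℤ => qh p ^ (-j ^ 2 - j * (2 * s + 1))) (by
    intro j
    apply qh_per p hp _ _ (-2 * j - 4 * p - (2 * s + 1))
    push_cast
    ring) (2 * p)
  have h2 : ∀ j : ℤ, qh p ^ (-(j + 2 * p) ^ 2 - (j + 2 * p) * (2 * s + 1)) =
      - qh p ^ (-j ^ 2 - j * (2 * s + 1)) := by
    intro j
    apply qh_half p hp _ _ (-j - p - s - 1)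
    ring
  simp only [h2] at h
  rw [Finset.sum_neg_distrib] at h
  have h3 : ∀ x : ℂ, -x = x → x = 0 := by
    intro x hx
    have : (2 : ℂ) * x = 0 := by linear_combination -hx
    simpa using this
  exact h3 _ h

end Scalars
end LogHennings

namespace LogHennings
section Abstract

/-- Data of the relations of the restricted quantum group in an algebra. -/
structure Tri (p : ℕ) (A : Type*) [Ring A] [Algebra ℂ A] where
  e : A
  f : A
  K : Aˣ
  Ke : (K : A) * e = (qq p ^ 2) • (e * K)
  Kf : (K : A) * f = (qq p ^ 2)⁻¹ • (f * K)
  ef : e * f - f * e = (qq p - (qq p)⁻¹)⁻¹ • ((K : A) - ((K⁻¹ : Aˣ) : A))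
  epow : e ^ p = 0
  fpow : f ^ p = 0
  Kpow : K ^ (2 * p) = 1

variable {p : ℕ} {A : Type*} [Ring A] [Algebra ℂ A]

lemma unit_pow_comm (K : Aˣ) (x : A) (a : ℂ) (h : (K : A) * x = a • (x * K)) (m : ℕ) :
    (K : A) * x ^ m = a ^ m • (x ^ m * K) := by
  induction m with
  | zero => simp
  | succ m ih =>
    rw [pow_succ, ← mul_assoc, ih, smul_mul_assoc, mul_assoc, h, mul_smul_comm, smul_smul,
      ← pow_succ, mul_assoc]

lemma unit_zpow_comm (K : Aˣ) (x : A) (a : ℂ) (ha : a ≠ 0) (h : (K : A) * x = a • (x * K))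
    (j : ℤ) : ((K ^ j : Aˣ) : A) * x = a ^ j • (x * ((K ^ j : Aˣ) : A)) := by
  have hinv : ((K⁻¹ : Aˣ) : A) * x = a⁻¹ • (x * ((K⁻¹ : Aˣ) : A)) := by
    rw [Units.inv_mul_eq_iff_eq_mul, mul_smul_comm, ← mul_assoc, h, smul_mul_assoc, smul_smul,
      inv_mul_cancel₀ ha, one_smul, Units.mul_inv_cancel_right]
  induction j using Int.induction_on with
  | zero => simp
  | succ i ih =>
    rw [zpow_add_one, Units.val_mul, mul_assoc, h, mul_smul_comm, ← mul_assoc, ih,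
      smul_mul_assoc, smul_smul, zpow_add_one₀ ha, mul_comm a, mul_assoc]
  | pred i ih =>
    rw [zpow_sub_one, Units.val_mul, mul_assoc, hinv, mul_smul_comm, ← mul_assoc, ih,
      smul_mul_assoc, smul_smul, zpow_sub_one₀ ha, mul_comm a⁻¹, mul_assoc]

lemma qnum_rec (p : ℕ) (hp : 2 ≤ p) (n : ℕ) :
    qnum p (n + 1 + 1) / (qq p - (qq p)⁻¹) * qq p ^ (-((n + 1 : ℕ) : ℤ)) =
      (qq p - (qq p)⁻¹)⁻¹ + qnum p (n + 1) / (qq p - (qq p)⁻¹) * qq p ^ (-(n : ℤ) + -2) ∧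
    qnum p (n + 1 + 1) / (qq p - (qq p)⁻¹) * qq p ^ ((n + 1 : ℕ) : ℤ) =
      (qq p - (qq p)⁻¹)⁻¹ + qnum p (n + 1) / (qq p - (qq p)⁻¹) * qq p ^ ((n : ℤ) + 2) := by
  have hd := d_ne p hp
  have hq := qq_ne p
  have a1 : qq p ^ (-((n + 1 : ℕ) : ℤ)) = (qq p)⁻¹ ^ n * (qq p)⁻¹ := by
    rw [zpow_neg, zpow_natCast, ← inv_pow, pow_succ]
  have a2 : qq p ^ (-(n : ℤ) + -2) = (qq p)⁻¹ ^ n * (qq p)⁻¹ ^ 2 := by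
    rw [← neg_add, zpow_neg, ← inv_zpow, ← pow_add]
    exact_mod_cast rfl
  have a3 : qq p ^ ((n + 1 : ℕ) : ℤ) = qq p ^ n * qq p := by
    rw [zpow_natCast, pow_succ]
  have a4 : qq p ^ ((n : ℤ) + 2) = qq p ^ n * qq p ^ 2 := by
    rw [← pow_add]
    exact_mod_cast rfl
  rw [a1, a2, a3, a4, qnum, qnum, pow_succ _ (n + 1), pow_succ _ (n + 1), pow_succ _ n,
    pow_succ _ n]
  have hxy : qq p ^ n * (qq p)⁻¹ ^ n = 1 := by rw [← mul_pow, mul_inv_cancel₀ hq, one_pow]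
  have hqr : qq p * (qq p)⁻¹ = 1 := mul_inv_cancel₀ hq
  generalize qq p ^ n = x at *
  generalize (qq p)⁻¹ ^ n = y at *
  generalize (qq p)⁻¹ = r at *
  generalize qq p = t at *
  obtain ⟨d, hde⟩ : ∃ d, d = t - r := ⟨_, rfl⟩
  rw [← hde] at hd ⊢
  constructor
  · field_simp
    rw [hde]
    linear_combination (t ^ 2 * r - t * r ^ 2) * hxy + (t - r) * hqr
  · field_simp
    rw [hde]
    linear_combination (r * t ^ 2 - r ^ 2 * t) * hxy + (t - r) * hqr

lemma qq2_ne (p : ℕ) : qq p ^ 2 ≠ 0 := pow_ne_zero 2 (qq_ne p)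

namespace Tri
variable (T : Tri p A)

/-- integer powers of `K` as elements of the algebra. -/
def Z (j : ℤ) : A := ((T.K ^ j : Aˣ) : A)

lemma Z_mul (i j : ℤ) : T.Z i * T.Z j = T.Z (i + j) := by
  rw [Z, Z, Z, zpow_add, Units.val_mul]

lemma Z_zero : T.Z 0 = 1 := by simp [Z]
lemma Z_one : T.Z 1 = T.K := by simp [Z]
lemma Z_neg_one : T.Z (-1) = ((T.K⁻¹ : Aˣ) : A) := by simp [Z]

lemma Z_per (j : ℤ) : T.Z (j + (2 * p : ℕ)) = T.Z j := by
  rw [Z, Z, zpow_add, zpow_natCast, T.Kpow, mul_one]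

lemma Z_e (j : ℤ) (m : ℕ) : T.Z j * T.e ^ m = ((qq p ^ 2) ^ m) ^ j • (T.e ^ m * T.Z j) :=
  unit_zpow_comm T.K _ _ (pow_ne_zero _ (qq2_ne p)) (unit_pow_comm _ _ _ T.Ke m) j

lemma Z_f (j : ℤ) (m : ℕ) : T.Z j * T.f ^ m = ((qq p ^ 2)⁻¹ ^ m) ^ j • (T.f ^ m * T.Z j) :=
  unit_zpow_comm T.K _ _ (pow_ne_zero _ (inv_ne_zero (qq2_ne p))) (unit_pow_comm _ _ _ T.Kf m) j

lemma Z_e1 (j : ℤ) : T.Z j * T.e = (qq p ^ 2) ^ j • (T.e * T.Z j) := by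
  simpa using T.Z_e j 1

lemma Z_f1 (j : ℤ) : T.Z j * T.f = (qq p ^ 2)⁻¹ ^ j • (T.f * T.Z j) := by
  simpa using T.Z_f j 1

lemma Z_fe (j : ℤ) (m : ℕ) : T.Z j * (T.f ^ m * T.e ^ m) = T.f ^ m * T.e ^ m * T.Z j := by
  rw [← mul_assoc, Z_f, smul_mul_assoc, mul_assoc, Z_e, mul_smul_comm, smul_smul, ← mul_zpow,
    ← mul_pow, inv_mul_cancel₀ (qq2_ne p), one_pow, one_zpow, one_smul, mul_assoc]

/-- The opposite data. -/
def op : Tri p Aᵐᵒᵖ where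
  e := MulOpposite.op T.f
  f := MulOpposite.op T.e
  K := Units.opEquiv.symm (MulOpposite.op T.K)
  Ke := by
    rw [Units.coe_opEquiv_symm, MulOpposite.unop_op, ← MulOpposite.op_mul, ← MulOpposite.op_mul,
      ← MulOpposite.op_smul, T.Kf, smul_smul, mul_inv_cancel₀ (qq2_ne p), one_smul]
  Kf := by
    rw [Units.coe_opEquiv_symm, MulOpposite.unop_op, ← MulOpposite.op_mul, ← MulOpposite.op_mul,
      ← MulOpposite.op_smul, T.Ke, smul_smul, inv_mul_cancel₀ (qq2_ne p), one_smul]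
  ef := by
    rw [← map_inv, ← MulOpposite.op_inv, Units.coe_opEquiv_symm, Units.coe_opEquiv_symm,
      MulOpposite.unop_op, MulOpposite.unop_op, ← MulOpposite.op_mul, ← MulOpposite.op_mul,
      ← MulOpposite.op_sub, ← MulOpposite.op_sub, ← MulOpposite.op_smul, T.ef]
  epow := by rw [← MulOpposite.op_pow, T.fpow, MulOpposite.op_zero]
  fpow := by rw [← MulOpposite.op_pow, T.epow, MulOpposite.op_zero]
  Kpow := by rw [← map_pow, ← MulOpposite.op_pow, T.Kpow, MulOpposite.op_one, map_one]

lemma op_Z (j : ℤ) : T.op.Z j = MulOpposite.op (T.Z j) := by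
  simp only [Z, op]
  rw [← map_zpow, ← MulOpposite.op_zpow, Units.coe_opEquiv_symm, MulOpposite.unop_op]

/-- Cartan part of the ribbon element. -/
def av (m : ℕ) : A := ∑ j ∈ range (2 * p), Bc p m j • T.Z j

/-- The unnormalised ribbon element. -/
def rg : A := ∑ m ∈ range p, T.f ^ m * T.e ^ m * T.av m

lemma op_av (m : ℕ) : T.op.av m = MulOpposite.op (T.av m) := by
  simp only [av, op_Z, Finset.op_sum, MulOpposite.op_smul]

lemma av_fe (m n : ℕ) : T.av n * (T.f ^ m * T.e ^ m) = T.f ^ m * T.e ^ m * T.av n := by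
  rw [av, Finset.sum_mul, Finset.mul_sum]
  refine Finset.sum_congr rfl fun j _ => ?_
  rw [smul_mul_assoc, mul_smul_comm, Z_fe]

lemma op_rg : T.op.rg = MulOpposite.op T.rg := by
  rw [rg, rg, Finset.op_sum]
  refine Finset.sum_congr rfl fun m _ => ?_
  rw [op_av, ← av_fe, MulOpposite.op_mul, MulOpposite.op_mul, MulOpposite.op_pow,
    MulOpposite.op_pow]
  simp only [op]

lemma av_star (hp : 2 ≤ p) (m : ℕ) (hm : m + 1 < p) :
    (∑ j ∈ range (2 * p), (Bc p m j * (qq p ^ 2) ^ (j : ℤ)) • T.Z j) - T.av m =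
      (qnum p (m + 1) / (qq p - (qq p)⁻¹)) •
        (qq p ^ ((m : ℤ) + 2) • (T.Z 1 * T.av (m + 1))
          - qq p ^ (-((m : ℤ) + 2)) • (T.Z (-1) * T.av (m + 1))) := by
  have h1 : T.Z 1 * T.av (m + 1) = ∑ j ∈ range (2 * p), Bc p (m + 1) ((j : ℤ) - 1) • T.Z j := by
    rw [← sum_shift (2 * p) (fun j : ℤ => Bc p (m + 1) (j - 1) • T.Z j) _ 1, av, Finset.mul_sum]
    · refine Finset.sum_congr rfl fun j _ => ?_
      rw [mul_smul_comm, Z_mul, add_comm 1, add_sub_cancel_right]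
    · intro j
      rw [Z_per, ← Bc_per p (by omega) (m + 1) (j - 1)]
      congr 2
      ring
  have h2 : T.Z (-1) * T.av (m + 1) =
      ∑ j ∈ range (2 * p), Bc p (m + 1) ((j : ℤ) + 1) • T.Z j := by
    rw [← sum_shift (2 * p) (fun j : ℤ => Bc p (m + 1) (j + 1) • T.Z j) _ (-1), av,
      Finset.mul_sum]
    · refine Finset.sum_congr rfl fun j _ => ?_
      rw [mul_smul_comm, Z_mul, add_comm (-1), neg_add_cancel_right]
    · intro j
      rw [Z_per, ← Bc_per p (by omega) (m + 1) (j + 1)]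
      congr 2
      ring
  rw [h1, h2, av, ← Finset.sum_sub_distrib, Finset.smul_sum, Finset.smul_sum,
    ← Finset.sum_sub_distrib, Finset.smul_sum]
  refine Finset.sum_congr rfl fun j _ => ?_
  rw [← sub_smul, smul_smul, smul_smul, ← sub_smul, smul_smul, Bc_rec p hp m hm]

lemma e_f_pow (hp : 2 ≤ p) (n : ℕ) :
    T.e * T.f ^ (n + 1) = T.f ^ (n + 1) * T.e + (qnum p (n + 1) / (qq p - (qq p)⁻¹)) •
      (T.f ^ n * (qq p ^ (-(n : ℤ)) • T.Z 1 - qq p ^ (n : ℤ) • T.Z (-1))) := by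
  have hd := d_ne p hp
  have hq := qq_ne p
  have hef : T.e * T.f = T.f * T.e + (qq p - (qq p)⁻¹)⁻¹ • (T.Z 1 - T.Z (-1)) := by
    rw [Z_one, Z_neg_one, ← T.ef]; abel
  induction n with
  | zero =>
    have : qnum p (0 + 1) = 1 := by simp [qnum, div_self hd]
    rw [this]
    simp [hef]
  | succ n ih =>
    rw [pow_succ, ← mul_assoc, ih, add_mul, mul_assoc, hef, smul_mul_assoc, mul_assoc, sub_mul,
      smul_mul_assoc, smul_mul_assoc, Z_f1, Z_f1]
    have e1 : (qq p ^ 2)⁻¹ ^ (1 : ℤ) = qq p ^ (-2 : ℤ) := by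
      rw [zpow_one, zpow_neg]; norm_cast
    have e2 : (qq p ^ 2)⁻¹ ^ (-1 : ℤ) = qq p ^ (2 : ℤ) := by
      rw [zpow_neg_one, inv_inv]; norm_cast
    rw [e1, e2, smul_smul, smul_smul, ← zpow_add₀ hq, ← zpow_add₀ hq]
    have hg1 : T.f ^ n * (T.f * T.Z 1) = T.f ^ (n + 1) * T.Z 1 := by rw [← mul_assoc, pow_succ]
    have hg2 : T.f ^ n * (T.f * T.Z (-1)) = T.f ^ (n + 1) * T.Z (-1) := by
      rw [← mul_assoc, pow_succ]
    have hg3 : T.f ^ (n + 1) * (T.f * T.e) = T.f ^ (n + 1 + 1) * T.e := by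
      rw [← mul_assoc, pow_succ T.f (n + 1)]
    rw [← pow_succ T.f (n + 1)]
    simp only [mul_add, mul_sub, mul_smul_comm, smul_sub, smul_smul, hg1, hg2, hg3]
    rw [add_assoc]
    congr 1
    obtain ⟨c1, c2⟩ := qnum_rec p hp n
    rw [c1, c2, add_smul, add_smul]
    abel

lemma comm_e (hp : 2 ≤ p) : T.e * T.rg = T.rg * T.e := by
  obtain ⟨P, rfl⟩ : ∃ P, p = P + 1 := ⟨p - 1, by omega⟩
  set X : ℕ → A := fun m => (qnum (P + 1) (m + 1) / (qq (P + 1) - (qq (P + 1))⁻¹)) •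
      (T.f ^ m * (qq (P + 1) ^ (-(m : ℤ)) • T.Z 1 - qq (P + 1) ^ (m : ℤ) • T.Z (-1)) *
        T.e ^ (m + 1) * T.av (m + 1)) with hX
  set ash : ℕ → A := fun m =>
    ∑ j ∈ range (2 * (P + 1)), (Bc (P + 1) m j * (qq (P + 1) ^ 2) ^ (j : ℤ)) • T.Z j with hash
  have hW : ∀ m, T.f ^ m * T.e ^ m * T.av m * T.e = T.f ^ m * T.e ^ (m + 1) * ash m := by
    intro m
    have : T.av m * T.e = T.e * ash m := by
      rw [av, Finset.sum_mul, Finset.mul_sum]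
      refine Finset.sum_congr rfl fun j _ => ?_
      rw [smul_mul_assoc, Z_e1, smul_smul, mul_smul_comm]
    rw [mul_assoc, this, pow_succ]
    simp only [mul_assoc]
  have hWX : ∀ m, m < P → T.f ^ m * T.e ^ (m + 1) * ash m =
      T.f ^ m * T.e ^ (m + 1) * T.av m + X m := by
    intro m hm
    have h := T.av_star hp m (by omega)
    rw [sub_eq_iff_eq_add] at h
    rw [hash]
    simp only
    rw [h, mul_add, add_comm, hX]
    congr 1
    simp only
    rw [mul_smul_comm, mul_assoc (T.f ^ m) (_ - _), sub_mul, smul_mul_assoc, smul_mul_assoc,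
      Z_e, Z_e, smul_smul, smul_smul]
    have c1 : qq (P + 1) ^ (-(m : ℤ)) * ((qq (P + 1) ^ 2) ^ (m + 1)) ^ (1 : ℤ) =
        qq (P + 1) ^ ((m : ℤ) + 2) := by
      rw [← pow_mul, ← zpow_natCast, ← zpow_mul, ← zpow_add₀ (qq_ne _)]
      congr 1
      push_cast
      ring
    have c2 : qq (P + 1) ^ (m : ℤ) * ((qq (P + 1) ^ 2) ^ (m + 1)) ^ (-1 : ℤ) =
        qq (P + 1) ^ (-((m : ℤ) + 2)) := by
      rw [← pow_mul, ← zpow_natCast, ← zpow_mul, ← zpow_add₀ (qq_ne _)]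
      congr 1
      push_cast
      ring
    rw [c1, c2]
    simp only [mul_sub, sub_mul, mul_smul_comm, smul_mul_assoc, mul_assoc]
  have hL : ∀ m, T.e * (T.f ^ (m + 1) * T.e ^ (m + 1) * T.av (m + 1)) =
      T.f ^ (m + 1) * T.e ^ (m + 1 + 1) * T.av (m + 1) + X m := by
    intro m
    rw [← mul_assoc, ← mul_assoc, e_f_pow T hp, add_mul, add_mul, hX, pow_succ' T.e (m + 1)]
    simp only [smul_mul_assoc, mul_assoc]
  have h0 : T.e ^ (P + 1) = 0 := T.epow
  rw [rg, Finset.mul_sum, Finset.sum_mul, Finset.sum_congr rfl fun m _ => hW m,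
    Finset.sum_range_succ (fun m => T.f ^ m * T.e ^ (m + 1) * ash m), h0,
    Finset.sum_congr rfl fun m hm => hWX m (Finset.mem_range.mp hm), Finset.sum_add_distrib,
    Finset.sum_range_succ', Finset.sum_congr rfl fun m _ => hL m, Finset.sum_add_distrib]
  have h1 := Finset.sum_range_succ' (fun m => T.f ^ m * T.e ^ (m + 1) * T.av m) P
  rw [Finset.sum_range_succ, h0] at h1
  simp only [mul_zero, zero_mul, add_zero, pow_zero, one_mul, zero_add, pow_one] at h1 ⊢
  rw [h1]
  abel

lemma comm_f (hp : 2 ≤ p) : T.f * T.rg = T.rg * T.f := by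
  have h := T.op.comm_e hp
  rw [op_rg] at h
  exact (congrArg MulOpposite.unop h).symm

lemma comm_Z (j : ℤ) : T.Z j * T.rg = T.rg * T.Z j := by
  rw [rg, Finset.mul_sum, Finset.sum_mul]
  refine Finset.sum_congr rfl fun m _ => ?_
  rw [← mul_assoc, Z_fe, mul_assoc, mul_assoc _ (T.av m), av, Finset.mul_sum, Finset.sum_mul]
  congr 1
  refine Finset.sum_congr rfl fun i _ => ?_
  rw [smul_mul_assoc, mul_smul_comm, Z_mul, Z_mul, add_comm]

lemma av0_inv (hp : 2 ≤ p) : ∃ b : A, b * T.av 0 = 1 ∧ b * T.rg = T.rg * b := by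
  refine ⟨(2 * (p : ℂ))⁻¹ • ∑ l ∈ range (2 * p), qh p ^ (-((l : ℤ) - (p + 1)) ^ 2) • T.Z l,
    ?_, ?_⟩
  · have hp0 : (2 * (p : ℂ)) ≠ 0 := by
      simp; omega
    have h1 : ∀ j : ℕ, (∑ l ∈ range (2 * p), qh p ^ (-((l : ℤ) - (p + 1)) ^ 2) • T.Z l) *
        (Bc p 0 j • T.Z j) = ∑ n ∈ range (2 * p),
          (qh p ^ (-(n : ℤ) ^ 2) * qh p ^ (2 * (n : ℤ) * ((j : ℤ) + (p + 1)))) • T.Z n := by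
      intro j
      rw [← sum_shift (2 * p) (fun n : ℤ =>
        (qh p ^ (-n ^ 2) * qh p ^ (2 * n * ((j : ℤ) + (p + 1)))) • T.Z n) _ j, Finset.sum_mul]
      · refine Finset.sum_congr rfl fun l _ => ?_
        rw [smul_mul_assoc, mul_smul_comm, Z_mul, smul_smul, Bc, gam, qfac]
        simp only [pow_zero, div_one, one_mul]
        rw [← zpow_add₀ (qh_ne p), ← zpow_add₀ (qh_ne p)]
        congr 2
        push_cast
        ring
      · intro n
        rw [Z_per, ← zpow_add₀ (qh_ne p), ← zpow_add₀ (qh_ne p)]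
        congr 1
        apply qh_per p (by omega) _ _ (-n - p + j + p + 1)
        push_cast
        ring
    rw [smul_mul_assoc, av, Finset.mul_sum, Finset.sum_congr rfl fun j _ => h1 j,
      Finset.sum_comm]
    simp_rw [← Finset.sum_smul, ← Finset.mul_sum]
    have h2 : ∀ n ∈ range (2 * p), (qh p ^ (-(n : ℤ) ^ 2) *
        ∑ j ∈ range (2 * p), qh p ^ (2 * (n : ℤ) * ((j : ℤ) + (p + 1)))) • T.Z n =
        if n = 0 then (2 * (p : ℂ)) • (1 : A) else 0 := by
      intro n hn
      rw [sum_qh p (by omega) n (Finset.mem_range.mp hn)]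
      split_ifs with h
      · subst h
        simp [Z_zero]
      · simp
    rw [Finset.sum_congr rfl h2, Finset.sum_ite_eq' (range (2 * p)) 0,
      if_pos (Finset.mem_range.mpr (by omega)), smul_smul, inv_mul_cancel₀ hp0, one_smul]
  · rw [smul_mul_assoc, mul_smul_comm, Finset.sum_mul, Finset.mul_sum]
    congr 1
    refine Finset.sum_congr rfl fun i _ => ?_
    rw [smul_mul_assoc, mul_smul_comm, comm_Z]

lemma rg_dvd (hp : 2 ≤ p) (n : ℕ) : ∀ s, p ≤ s + n → T.rg ∣ T.e ^ s := by
  obtain ⟨b, hb, hbr⟩ := T.av0_inv hp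
  have hav : ∀ m s, ∃ a' : A, T.av m * T.e ^ s = T.e ^ s * a' := by
    intro m s
    refine ⟨∑ j ∈ range (2 * p), (Bc p m j * ((qq p ^ 2) ^ s) ^ (j : ℤ)) • T.Z j, ?_⟩
    rw [av, Finset.sum_mul, Finset.mul_sum]
    refine Finset.sum_congr rfl fun j _ => ?_
    rw [smul_mul_assoc, Z_e, smul_smul, mul_smul_comm]
  have hmul : ∀ c z : A, c * T.rg = T.rg * c → T.rg ∣ z → T.rg ∣ c * z := by
    rintro c z hc ⟨y, rfl⟩
    exact ⟨c * y, by rw [← mul_assoc, hc, mul_assoc]⟩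
  have hfm : ∀ m : ℕ, T.f ^ m * T.rg = T.rg * T.f ^ m := by
    intro m
    have : Commute T.f T.rg := T.comm_f hp
    exact this.pow_left m
  induction n with
  | zero =>
    intro s hs
    rw [show s = p + (s - p) by omega, pow_add, T.epow, zero_mul]
    exact dvd_zero _
  | succ n ih =>
    intro s hs
    obtain ⟨P, hP⟩ : ∃ P, p = P + 1 := ⟨p - 1, by omega⟩
    have h1 : T.rg = ∑ m ∈ range P, T.f ^ (m + 1) * T.e ^ (m + 1) * T.av (m + 1) + T.av 0 := by
      rw [rg]
      conv_lhs => rw [show range p = range (P + 1) by rw [hP]]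
      rw [Finset.sum_range_succ']
      simp
    have h2 : b * (T.rg * T.e ^ s) = b * (∑ m ∈ range P,
        T.f ^ (m + 1) * T.e ^ (m + 1) * T.av (m + 1) * T.e ^ s) + T.e ^ s := by
      conv_lhs => rw [h1, add_mul, Finset.sum_mul, mul_add, ← mul_assoc b (T.av 0), hb, one_mul]
    have h3 : T.e ^ s = b * (T.rg * T.e ^ s) - b * (∑ m ∈ range P,
        T.f ^ (m + 1) * T.e ^ (m + 1) * T.av (m + 1) * T.e ^ s) := by
      rw [h2]; abel
    rw [h3]
    apply dvd_sub
    · exact hmul _ _ hbr (Dvd.intro _ rfl)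
    · apply hmul _ _ hbr
      apply Finset.dvd_sum
      intro m _
      obtain ⟨a', ha'⟩ := hav (m + 1) s
      rw [mul_assoc, ha', mul_assoc]
      apply hmul _ _ (hfm _)
      rw [← mul_assoc, ← pow_add]
      exact (ih _ (by omega)).mul_right _

lemma rg_unit (hp : 2 ≤ p) : ∃ y : A, T.rg * y = 1 ∧ y * T.rg = 1 := by
  obtain ⟨y, hy⟩ := T.rg_dvd hp p 0 (by omega)
  obtain ⟨z, hz⟩ := T.op.rg_dvd hp p 0 (by omega)
  rw [pow_zero] at hy hz
  rw [op_rg] at hz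
  have hz' : 1 = z.unop * T.rg := congrArg MulOpposite.unop hz
  have : z.unop = y := by
    calc z.unop = z.unop * (T.rg * y) := by rw [← hy, mul_one]
      _ = y := by rw [← mul_assoc, ← hz', one_mul]
  exact ⟨y, hy.symm, by rw [← this, ← hz']⟩

end Tri
end Abstract
end LogHennings

namespace LogHennings
section Drinfeld
variable {p : ℕ} {A : Type*} [Ring A] [Algebra ℂ A]

lemma sum_even_odd (N : ℕ) (F : ℕ → A) :
    ∑ t ∈ range (2 * N), F t = ∑ s ∈ range N, (F (2 * s) + F (2 * s + 1)) := by
  induction N with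
  | zero => simp
  | succ N ih =>
    rw [show 2 * (N + 1) = 2 * N + 1 + 1 by ring, Finset.sum_range_succ, Finset.sum_range_succ, ih,
      Finset.sum_range_succ, add_assoc]

lemma dsum (hp : 0 < p) (k : Aˣ) (hk : k ^ (4 * p) = 1) (m : ℕ) :
    ∑ n ∈ range (4 * p), ∑ j ∈ range (4 * p),
      qh p ^ (2 * (m : ℤ) * ((n : ℤ) - (j : ℤ)) - (n : ℤ) * (j : ℤ)) •
        ((k ^ (2 * (m : ℤ) + n - j) : Aˣ) : A) =
    (2 * ((1 - Complex.I) * (Real.sqrt p : ℂ))) •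
      ∑ s ∈ range (2 * p), qh p ^ (4 * (m : ℤ) * s + (s : ℤ) ^ 2) •
        ((k ^ (2 * ((m : ℤ) + s)) : Aˣ) : A) := by
  have hper : ∀ i : ℤ, k ^ (i + (4 * p : ℕ)) = k ^ i := by
    intro i
    rw [zpow_add, zpow_natCast, hk, mul_one]
  rw [Finset.sum_comm]
  have h1 : ∀ j : ℕ, ∑ n ∈ range (4 * p),
      qh p ^ (2 * (m : ℤ) * ((n : ℤ) - (j : ℤ)) - (n : ℤ) * (j : ℤ)) •
        ((k ^ (2 * (m : ℤ) + n - j) : Aˣ) : A) =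
      ∑ t ∈ range (4 * p), (qh p ^ (2 * (m : ℤ) * t) * qh p ^ (-(j : ℤ) ^ 2 - (j : ℤ) * t)) •
        ((k ^ (2 * (m : ℤ) + t) : Aˣ) : A) := by
    intro j
    rw [← sum_shift (4 * p) (fun n : ℤ =>
      qh p ^ (2 * (m : ℤ) * (n - (j : ℤ)) - n * (j : ℤ)) •
        ((k ^ (2 * (m : ℤ) + n - j) : Aˣ) : A)) _ j]
    · refine Finset.sum_congr rfl fun t _ => ?_
      rw [← zpow_add₀ (qh_ne p)]
      congr 2
      · ring
      · congr 2
        ring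
    · intro n
      rw [show 2 * (m : ℤ) + (n + (4 * p : ℕ)) - j = (2 * (m : ℤ) + n - j) + (4 * p : ℕ) by ring,
        hper]
      congr 1
      apply qh_per p hp _ _ (2 * m - j)
      push_cast
      ring
  rw [Finset.sum_congr rfl fun j _ => h1 j, Finset.sum_comm]
  simp_rw [← Finset.sum_smul, ← Finset.mul_sum]
  have h2 := sum_even_odd (2 * p) (fun t : ℕ => (qh p ^ (2 * (m : ℤ) * t) *
    ∑ j ∈ range (4 * p), qh p ^ (-(j : ℤ) ^ 2 - (j : ℤ) * t)) •
      ((k ^ (2 * (m : ℤ) + t) : Aˣ) : A))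
  rw [show 2 * (2 * p) = 4 * p by ring] at h2
  rw [h2, Finset.smul_sum]
  refine Finset.sum_congr rfl fun s _ => ?_
  push_cast
  rw [gauss_t p hp, gauss_odd p hp, mul_zero, zero_smul, add_zero, smul_smul]
  congr 1
  · rw [zpow_add₀ (qh_ne p), show 2 * (m : ℤ) * (2 * s) = 4 * m * s by ring]
    ring
  · congr 2
    ring

namespace Tri
variable (T : Tri p A)

lemma Kf_pow (m : ℕ) : ((T.K : A) * T.f) ^ m =
    qh p ^ (2 * (m : ℤ) * ((m : ℤ) - 1)) • (T.Z m * T.f ^ m) := by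
  induction m with
  | zero => simp [Z_zero]
  | succ m ih =>
    have h := T.Z_f1 m
    rw [pow_succ, ih, smul_mul_assoc, ← Z_one, mul_assoc (T.Z m), ← mul_assoc (T.f ^ m)]
    have h2 := T.Z_f 1 m
    have h3 : T.f ^ m * T.Z 1 = (qq p ^ 2) ^ m • (T.Z 1 * T.f ^ m) := by
      rw [h2, smul_smul, zpow_one, ← mul_pow, mul_inv_cancel₀ (qq2_ne p), one_pow, one_smul]
    rw [h3, smul_mul_assoc, mul_smul_comm, smul_smul, mul_assoc (T.Z 1), ← mul_assoc (T.Z m), Z_mul,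
      ← pow_succ]
    have h4 : (qq p ^ 2) ^ m = qh p ^ (4 * (m : ℤ)) := by
      rw [qq_eq, ← pow_mul, ← zpow_natCast, ← zpow_mul]
      congr 1
      push_cast
      ring
    rw [h4, ← zpow_add₀ (qh_ne p)]
    congr 2
    push_cast
    ring

lemma u_term (k : Aˣ) (hk : k ^ 2 = T.K) (hke : (k : A) * T.e = qq p • (T.e * k))
    (hkf : (k : A) * T.f = (qq p)⁻¹ • (T.f * k)) (m n j : ℕ) :
    ((k⁻¹ : Aˣ) : A) ^ j * (-((k : A) ^ 2 * T.f)) ^ m * (T.e ^ m * (k : A) ^ n) =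
      ((-1) ^ m * qh p ^ (2 * (m : ℤ) * ((m : ℤ) - 1))) •
        (T.f ^ m * T.e ^ m * ((k ^ (2 * (m : ℤ) + n - j) : Aˣ) : A)) := by
  have hZ : ∀ i : ℤ, T.Z i = ((k ^ (2 * i) : Aˣ) : A) := by
    intro i
    rw [Z, ← hk, ← zpow_natCast, ← zpow_mul]
    rfl
  have hcomm : ∀ i : ℤ, ((k ^ i : Aˣ) : A) * (T.f ^ m * T.e ^ m) =
      T.f ^ m * T.e ^ m * ((k ^ i : Aˣ) : A) := by
    intro i
    rw [← mul_assoc, unit_zpow_comm k _ _ (pow_ne_zero m (inv_ne_zero (qq_ne p)))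
      (unit_pow_comm k _ _ hkf m) i, smul_mul_assoc, mul_assoc,
      unit_zpow_comm k _ _ (pow_ne_zero m (qq_ne p)) (unit_pow_comm k _ _ hke m) i,
      mul_smul_comm, smul_smul, ← mul_zpow, ← mul_pow, inv_mul_cancel₀ (qq_ne p), one_pow,
      one_zpow, one_smul, mul_assoc]
  have e1 : ((k⁻¹ : Aˣ) : A) ^ j = ((k ^ (-(j : ℤ)) : Aˣ) : A) := by
    rw [zpow_neg, zpow_natCast, ← inv_pow, Units.val_pow_eq_pow_val]
  have e2 : (k : A) ^ n = ((k ^ (n : ℤ) : Aˣ) : A) := by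
    rw [zpow_natCast, Units.val_pow_eq_pow_val]
  have e3 : (k : A) ^ 2 = (T.K : A) := by rw [← hk, Units.val_pow_eq_pow_val]
  have e4 : ((-1 : A)) ^ m = ((-1 : ℂ) ^ m) • (1 : A) := by
    rw [← Algebra.algebraMap_eq_smul_one, map_pow, map_neg, map_one]
  rw [e1, e2, e3, neg_pow, e4, smul_mul_assoc, one_mul, Kf_pow, smul_smul, mul_smul_comm,
    smul_mul_assoc, hZ]
  congr 1
  have e5 : ∀ a b c d g : A, a * (b * c) * (d * g) = a * (b * (c * d)) * g := by
    intros
    simp only [mul_assoc]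
  have e6 : ∀ a b c d : A, a * b * c * d = a * (b * c * d) := by
    intros
    simp only [mul_assoc]
  rw [e5, hcomm, ← mul_assoc, hcomm, e6, ← Units.val_mul, ← Units.val_mul, ← zpow_add,
    ← zpow_add]
  congr 3
  ring

lemma av_shift (hp : 0 < p) (m : ℕ) :
    (gam p m * (-1) ^ m * qh p ^ (3 * (m : ℤ) * ((m : ℤ) - 1))) •
      ∑ s ∈ range (2 * p), qh p ^ (4 * (m : ℤ) * s + (s : ℤ) ^ 2) • T.Z ((m : ℤ) + s) =
    T.av m * T.Z (p + 1) := by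
  rw [← sum_shift (2 * p) (fun s : ℤ => qh p ^ (4 * (m : ℤ) * s + s ^ 2) • T.Z ((m : ℤ) + s)) _
    (p + 1 - m), av, Finset.sum_mul, Finset.smul_sum]
  · refine Finset.sum_congr rfl fun j _ => ?_
    rw [smul_mul_assoc, Z_mul, smul_smul, Bc]
    have h1 : ((-1 : ℂ)) ^ m = qh p ^ (2 * (p : ℤ) * (-m)) := by
      rw [zpow_mul, qh_2p p hp, zpow_neg, zpow_natCast, ← inv_pow]
      norm_num
    rw [h1, mul_assoc (gam p m), mul_assoc (gam p m), ← zpow_add₀ (qh_ne p),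
      ← zpow_add₀ (qh_ne p)]
    congr 1
    · congr 2
      ring
    · congr 1
      ring
  · intro s
    rw [← add_assoc, Z_per]
    congr 1
    apply qh_per p hp _ _ (2 * m + s + p)
    push_cast
    ring

lemma u_form (hp : 0 < p) (k : Aˣ) (hk : k ^ 2 = T.K) (hke : (k : A) * T.e = qq p • (T.e * k))
    (hkf : (k : A) * T.f = (qq p)⁻¹ • (T.f * k)) :
    ((4 * (p : ℂ))⁻¹) • ∑ m ∈ range p, ∑ n ∈ range (4 * p), ∑ j ∈ range (4 * p),
      (gam p m * (qh p) ^ ((m : ℤ) * ((m : ℤ) - 1) + 2 * (m : ℤ) * ((n : ℤ) - (j : ℤ))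
            - (n : ℤ) * (j : ℤ))) •
        (((k⁻¹ : Aˣ) : A) ^ j * (-((k : A) ^ 2 * T.f)) ^ m * (T.e ^ m * (k : A) ^ n)) =
    (((1 - Complex.I) / (2 * (Real.sqrt p : ℂ))) • T.rg) * T.Z (p + 1) := by
  have hk4 : k ^ (4 * p) = 1 := by
    rw [show 4 * p = 2 * (2 * p) by ring, pow_mul, hk, T.Kpow]
  have hZ : ∀ i : ℤ, T.Z i = ((k ^ (2 * i) : Aˣ) : A) := by
    intro i
    rw [Z, ← hk, ← zpow_natCast, ← zpow_mul]
    rfl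
  have hterm : ∀ m : ℕ, ∑ n ∈ range (4 * p), ∑ j ∈ range (4 * p),
      (gam p m * (qh p) ^ ((m : ℤ) * ((m : ℤ) - 1) + 2 * (m : ℤ) * ((n : ℤ) - (j : ℤ))
            - (n : ℤ) * (j : ℤ))) •
        (((k⁻¹ : Aˣ) : A) ^ j * (-((k : A) ^ 2 * T.f)) ^ m * (T.e ^ m * (k : A) ^ n)) =
      (2 * ((1 - Complex.I) * (Real.sqrt p : ℂ))) •
        (T.f ^ m * T.e ^ m * (T.av m * T.Z (p + 1))) := by
    intro m
    rw [← av_shift T hp]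
    have h := T.u_term k hk hke hkf m
    have hd := dsum (A := A) hp k hk4 m
    simp_rw [hZ, h]
    rw [mul_smul_comm, smul_comm, ← mul_smul_comm, ← hd, Finset.mul_sum,
      Finset.smul_sum]
    refine Finset.sum_congr rfl fun n _ => ?_
    rw [Finset.mul_sum, Finset.smul_sum]
    refine Finset.sum_congr rfl fun j _ => ?_
    rw [mul_smul_comm, smul_smul, smul_smul]
    congr 1
    have : qh p ^ ((m : ℤ) * ((m : ℤ) - 1) + 2 * (m : ℤ) * ((n : ℤ) - (j : ℤ))
            - (n : ℤ) * (j : ℤ)) * qh p ^ (2 * (m : ℤ) * ((m : ℤ) - 1)) =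
        qh p ^ (3 * (m : ℤ) * ((m : ℤ) - 1)) *
          qh p ^ (2 * (m : ℤ) * ((n : ℤ) - (j : ℤ)) - (n : ℤ) * (j : ℤ)) := by
      rw [← zpow_add₀ (qh_ne p), ← zpow_add₀ (qh_ne p)]
      congr 1
      ring
    linear_combination (gam p m * (-1) ^ m) * this
  rw [Finset.sum_congr rfl fun m _ => hterm m, ← Finset.smul_sum, smul_smul, rg, smul_mul_assoc,
    Finset.sum_mul]
  simp_rw [mul_assoc]
  congr 1
  have hpR : (0 : ℝ) < p := by exact_mod_cast hp
  have hs : (Real.sqrt p : ℂ) ≠ 0 := by exact_mod_cast (Real.sqrt_pos.mpr hpR).ne'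
  have hs2 : (p : ℂ) = (Real.sqrt p : ℂ) ^ 2 := by
    norm_cast
    rw [Real.sq_sqrt hpR.le]
  rw [hs2]
  generalize (Real.sqrt p : ℂ) = x at *
  field_simp
  ring

end Tri
end Drinfeld
end LogHennings

namespace LogHennings
section Final
variable (p : ℕ)

/-- the unit `k` of `D`. -/
def kD : (Dq p)ˣ where
  val := Dk p
  inv := Dkinv p
  val_inv := by
    have h := RingQuot.mkAlgHom_rel ℂ (DRel.kkinv (p := p))
    rw [map_mul, map_one] at h
    exact h
  inv_val := by
    have h := RingQuot.mkAlgHom_rel ℂ (DRel.kinvk (p := p))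
    rw [map_mul, map_one] at h
    exact h

lemma kD_e : (kD p : Dq p) * De p = qq p • (De p * kD p) := by
  have h := RingQuot.mkAlgHom_rel ℂ (DRel.ke (p := p))
  rw [map_mul, map_mul, map_smul] at h
  change (kD p : Dq p) * De p * ((kD p)⁻¹ : (Dq p)ˣ) = qq p • De p at h
  rw [Units.mul_inv_eq_iff_eq_mul] at h
  rw [h, smul_mul_assoc]

lemma kD_f : (kD p : Dq p) * Dphi p = (qq p)⁻¹ • (Dphi p * kD p) := by
  have h := RingQuot.mkAlgHom_rel ℂ (DRel.kphi (p := p))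
  rw [map_mul, map_mul, map_smul] at h
  change (kD p : Dq p) * Dphi p * ((kD p)⁻¹ : (Dq p)ˣ) = (qq p)⁻¹ • Dphi p at h
  rw [Units.mul_inv_eq_iff_eq_mul] at h
  rw [h, smul_mul_assoc]

/-- The triangular data of `D`. -/
def TD : Tri p (Dq p) where
  e := De p
  f := Dphi p
  K := kD p ^ 2
  Ke := by
    have h := unit_zpow_comm (kD p) _ _ (qq_ne p) (kD_e p) 2
    exact_mod_cast h
  Kf := by
    have h := unit_zpow_comm (kD p) _ _ (inv_ne_zero (qq_ne p)) (kD_f p) 2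
    rw [← inv_pow]
    exact_mod_cast h
  ef := by
    have h := RingQuot.mkAlgHom_rel ℂ (DRel.ephi (p := p))
    rw [map_sub, map_mul, map_mul, map_smul, map_sub, map_pow, map_pow] at h
    rw [← inv_pow, Units.val_pow_eq_pow_val, Units.val_pow_eq_pow_val]
    exact h
  epow := by
    have h := RingQuot.mkAlgHom_rel ℂ (DRel.epow (p := p))
    rw [map_pow, map_zero] at h
    exact h
  fpow := by
    have h := RingQuot.mkAlgHom_rel ℂ (DRel.phipow (p := p))
    rw [map_pow, map_zero] at h
    exact h
  Kpow := by
    have h := RingQuot.mkAlgHom_rel ℂ (DRel.kpow (p := p))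
    rw [map_pow, map_one] at h
    rw [← pow_mul, show 2 * (2 * p) = 4 * p by ring]
    apply Units.ext
    rw [Units.val_pow_eq_pow_val]
    exact h

lemma TD_Z (j : ℕ) : (TD p).Z j = (Dk p ^ 2) ^ j := by
  rw [Tri.Z, zpow_natCast, Units.val_pow_eq_pow_val]
  change ((kD p ^ 2 : (Dq p)ˣ) : Dq p) ^ j = _
  rw [Units.val_pow_eq_pow_val]
  rfl

lemma rib_eq : rib p = ((1 - Complex.I) / (2 * (Real.sqrt p : ℂ))) • (TD p).rg := by
  rw [rib, Tri.rg]
  congr 1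
  refine Finset.sum_congr rfl fun m _ => ?_
  rw [Tri.av, Finset.mul_sum]
  refine Finset.sum_congr rfl fun j _ => ?_
  rw [TD_Z, mul_smul_comm, pow_mul]
  congr 1

lemma S_pow (SD : Dq p →ₗ[ℂ] Dq p) (h1 : SD 1 = 1) (hm : ∀ x y, SD (x * y) = SD y * SD x)
    (x : Dq p) (n : ℕ) : SD (x ^ n) = SD x ^ n := by
  induction n with
  | zero => simpa using h1
  | succ n ih => rw [pow_succ, hm, ih, ← pow_succ']

lemma u_eq (hp : 0 < p) (SD : Dq p →ₗ[ℂ] Dq p) (h : IsAntipodeD p SD) :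
    drinfeldU p SD = rib p * (TD p).Z (p + 1) := by
  rw [rib_eq, ← (TD p).u_form hp (kD p) rfl (kD_e p) (kD_f p)]
  obtain ⟨h1, hm, -, hf, hk, -⟩ := h
  rw [drinfeldU, R21, Rmat]
  simp only [map_smul, map_sum, TensorProduct.comm_tmul, TensorProduct.map_tmul,
    LinearMap.mul'_apply, LinearMap.id_apply]
  congr 1
  refine Finset.sum_congr rfl fun m _ => ?_
  refine Finset.sum_congr rfl fun n _ => ?_
  refine Finset.sum_congr rfl fun j _ => ?_
  rw [hm, S_pow p SD h1 hm, S_pow p SD h1 hm, hf, hk, gam]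
  rfl

/-- the unit `K` of `U`. -/
def KU : (Uq p)ˣ where
  val := UK p
  inv := UKinv p
  val_inv := by
    have h := RingQuot.mkAlgHom_rel ℂ (URel.KKinv (p := p))
    rw [map_mul, map_one] at h
    exact h
  inv_val := by
    have h := RingQuot.mkAlgHom_rel ℂ (URel.KinvK (p := p))
    rw [map_mul, map_one] at h
    exact h

lemma KU_pow : KU p ^ (2 * p) = 1 := by
  have h := RingQuot.mkAlgHom_rel ℂ (URel.Kpow (p := p))
  rw [map_pow, map_one] at h
  apply Units.ext
  rw [Units.val_pow_eq_pow_val]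
  exact h

lemma KU_E : UK p * UE p * UKinv p = (qq p ^ 2) • UE p := by
  have h := RingQuot.mkAlgHom_rel ℂ (URel.KE (p := p))
  rw [map_mul, map_mul, map_smul] at h
  exact h

lemma KU_F : UK p * UF p * UKinv p = (qq p ^ 2)⁻¹ • UF p := by
  have h := RingQuot.mkAlgHom_rel ℂ (URel.KF (p := p))
  rw [map_mul, map_mul, map_smul] at h
  exact h

lemma qq2_pow (hp : 0 < p) : (qq p ^ 2) ^ (p + 1) = qq p ^ 2 := by
  have h : (qq p ^ 2) ^ p = 1 := by
    rw [qq_eq, ← pow_mul, ← zpow_natCast, ← zpow_mul]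
    rw [show (2 : ℤ) * ((2 * p : ℕ) : ℤ) = 2 * p * 2 by push_cast; ring, zpow_mul, qh_2p p hp]
    norm_num
  rw [pow_succ, h, one_mul]

lemma conj_gen (hp : 0 < p) (x : Uq p) (a : ℂ) (ha : a ^ (p + 1) = a) (ha0 : a ≠ 0)
    (h : UK p * x * UKinv p = a • x) : gU p * x * UK p ^ (p - 1) = UK p * x * UKinv p := by
  have h1 : UK p ^ (p + 1) * UK p ^ (p - 1) = 1 := by
    rw [← pow_add, show p + 1 + (p - 1) = 2 * p by omega]
    have := congrArg Units.val (KU_pow p)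
    rwa [Units.val_pow_eq_pow_val] at this
  have hc : ((KU p : (Uq p)ˣ) : Uq p) * x = a • (x * KU p) := by
    have h' : (KU p : Uq p) * x * ((KU p)⁻¹ : (Uq p)ˣ) = a • x := h
    rw [Units.mul_inv_eq_iff_eq_mul] at h'
    rw [h', smul_mul_assoc]
  have h2 := unit_zpow_comm (KU p) x a ha0 hc ((p + 1 : ℕ) : ℤ)
  rw [zpow_natCast, zpow_natCast, ha, Units.val_pow_eq_pow_val] at h2
  change UK p ^ (p + 1) * x = a • (x * UK p ^ (p + 1)) at h2
  rw [h, gU, h2, smul_mul_assoc, mul_assoc, h1, mul_one]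

lemma conj_S2 (hp : 0 < p) (S : Uq p →ₗ[ℂ] Uq p) (hS : IsAntipodeU p S) (x : Uq p) :
    gU p * x * UK p ^ (p - 1) = S (S x) := by
  obtain ⟨s1, sm, sE, sF, sK, sKi⟩ := hS
  have nm1 : ∀ x y : Uq p, x * -y = -(x * y) := fun x y => mul_neg x y
  have nm2 : ∀ x y : Uq p, -x * y = -(x * y) := fun x y => neg_mul x y
  have nn : ∀ x : Uq p, - -x = x := fun x => neg_neg x
  have hKK : UK p * UKinv p = 1 := (KU p).val_inv
  have hKiK : UKinv p * UK p = 1 := (KU p).inv_val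
  have h1 : gU p * UK p ^ (p - 1) = 1 := by
    rw [gU, ← pow_add, show p + 1 + (p - 1) = 2 * p by omega]
    have := congrArg Units.val (KU_pow p)
    rwa [Units.val_pow_eq_pow_val] at this
  have h2 : UK p ^ (p - 1) * gU p = 1 := by
    rw [← h1, gU, ← pow_add, ← pow_add, add_comm]
  obtain ⟨x, rfl⟩ := RingQuot.mkAlgHom_surjective ℂ (URel p) x
  induction x using FreeAlgebra.induction with
  | grade0 r =>
    rw [AlgHom.commutes, Algebra.algebraMap_eq_smul_one, map_smul, map_smul, s1, s1,
      mul_smul_comm, mul_one, smul_mul_assoc, h1]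
  | grade1 g =>
    cases g with
    | E =>
      change gU p * UE p * _ = S (S (UE p))
      rw [sE, map_neg, sm, sE, sKi, nm1, nn, ← mul_assoc]
      exact conj_gen p hp _ _ (qq2_pow p hp) (qq2_ne p) (KU_E p)
    | F =>
      change gU p * UF p * _ = S (S (UF p))
      rw [sF, map_neg, sm, sF, sK, nm2, nn]
      exact conj_gen p hp _ _ (by rw [inv_pow, qq2_pow p hp]) (inv_ne_zero (qq2_ne p)) (KU_F p)
    | K =>
      change gU p * UK p * _ = S (S (UK p))
      rw [sK, sKi]
      rw [conj_gen p hp _ 1 (one_pow _) one_ne_zero (by rw [mul_assoc, hKK, mul_one, one_smul]),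
        mul_assoc, hKK, mul_one]
    | Kinv =>
      change gU p * UKinv p * _ = S (S (UKinv p))
      rw [sKi, sK]
      rw [conj_gen p hp _ 1 (one_pow _) one_ne_zero (by rw [hKK, one_mul, one_smul]), hKK, one_mul]
  | mul a b ha hb =>
    rw [map_mul, sm, sm, ← ha, ← hb]
    generalize RingQuot.mkAlgHom ℂ (URel p) a = a'
    generalize RingQuot.mkAlgHom ℂ (URel p) b = b'
    calc gU p * (a' * b') * UK p ^ (p - 1) = gU p * a' * 1 * b' * UK p ^ (p - 1) := by
          simp only [mul_assoc, one_mul]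
      _ = _ := by rw [← h2]; simp only [mul_assoc]
  | add a b ha hb =>
    rw [map_add, map_add, map_add, mul_add, add_mul, ha, hb]

end Final
end LogHennings

open LogHennings in
/-- The balancing element `g = K^{p+1}` is grouplike, implements `S²`, and
satisfies `ι(g) = r⁻¹ u`. -/
theorem balancing_element (p : ℕ) (hp : 2 ≤ p) :
    ∀ (Δ : Uq p →ₐ[ℂ] Uq p ⊗[ℂ] Uq p) (ε : Uq p →ₐ[ℂ] ℂ)
        (S : Uq p →ₗ[ℂ] Uq p) (SD : Dq p →ₗ[ℂ] Dq p) (ι : Uq p →ₐ[ℂ] Dq p),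
      IsDeltaU p Δ → IsCounitU p ε → IsAntipodeU p S → IsAntipodeD p SD →
      IsIota p ι →
      Δ (gU p) = gU p ⊗ₜ[ℂ] gU p ∧ ε (gU p) = 1 ∧
      gU p * UK p ^ (p - 1) = 1 ∧
      (∀ x : Uq p, gU p * x * UK p ^ (p - 1) = S (S x)) ∧
      ∃ rinv : Dq p, rib p * rinv = 1 ∧ rinv * rib p = 1 ∧
        ι (gU p) = rinv * drinfeldU p SD := by
  have hp0 : 0 < p := by omega
  intro Δ ε S SD ι hΔ hε hS hSD hι
  have h1 : gU p * UK p ^ (p - 1) = 1 := by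
    rw [gU, ← pow_add, show p + 1 + (p - 1) = 2 * p by omega]
    have := congrArg Units.val (KU_pow p)
    rwa [Units.val_pow_eq_pow_val] at this
  refine ⟨?_, ?_, h1, conj_S2 p hp0 S hS, ?_⟩
  · rw [gU, map_pow, hΔ.2.2.1, Algebra.TensorProduct.tmul_pow]
  · rw [gU, map_pow, hε.2.2.1, one_pow]
  · obtain ⟨y, hy1, hy2⟩ := (TD p).rg_unit hp
    have hpR : (0 : ℝ) < p := by exact_mod_cast hp0
    have hs : (Real.sqrt p : ℂ) ≠ 0 := by exact_mod_cast (Real.sqrt_pos.mpr hpR).ne'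
    have hI : (1 - Complex.I) ≠ 0 := by
      intro h
      have := congrArg Complex.re h
      simp at this
    have hc : (1 - Complex.I) / (2 * (Real.sqrt p : ℂ)) ≠ 0 :=
      div_ne_zero hI (mul_ne_zero two_ne_zero hs)
    have hl : (((1 - Complex.I) / (2 * (Real.sqrt p : ℂ)))⁻¹ • y) * rib p = 1 := by
      rw [rib_eq, smul_mul_smul_comm, inv_mul_cancel₀ hc, one_smul, hy2]
    refine ⟨((1 - Complex.I) / (2 * (Real.sqrt p : ℂ)))⁻¹ • y, ?_, hl, ?_⟩
    · rw [rib_eq, smul_mul_smul_comm, mul_inv_cancel₀ hc, one_smul, hy1]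
    · rw [u_eq p hp0 SD hSD, ← mul_assoc, hl, one_mul, gU, map_pow, hι.2.2.1, ← TD_Z]
      push_cast
      rfl
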